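/- (Lemma 4.2 (vi)–(vii) and Remark 4.3.) Fix γ ∈ (0,∞) and assume W is continuous and satisfies (H1), (H2) and the normalization of the wells. Then for every nonempty bounded open interval J ⊂ ℝ and every ρ > 0, 𝓔_γ(J, ρ) = K*_γ · ℒ¹(J), where K*_γ := 𝓔_γ(I, 1) and ℒ¹ denotes one-dimensional Lebesgue measure; in particular 𝓔_γ(J, ρ) does not depend on ρ. -/

import Mathlib

open MeasureTheory Filter Topology ENNReal NNReal Set

noncomputable section

/-- Vectors in ℝ³. -/
abbrev V3 := Fin 3 → ℝ

/-- 3×3 matrices, represented as the triple of their columns. -/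
abbrev M33 := Fin 3 → V3

/-- Euclidean norm on ℝ³. -/
def vnorm (v : V3) : ℝ := Real.sqrt (∑ i, (v i) ^ 2)

/-- Frobenius (Euclidean) norm on 3×3 matrices. -/
def mnorm (ξ : M33) : ℝ := Real.sqrt (∑ j, ∑ i, (ξ j i) ^ 2)

/-- dist(ξ,{A,B}). -/
def mdist (A B ξ : M33) : ℝ := min (mnorm (ξ - A)) (mnorm (ξ - B))

/-- Spatial points of ℝ³ = ℝ × ℝ × ℝ. -/
abbrev Pt := ℝ × ℝ × ℝ

/-- Directional partial derivative of a map `u : ℝ³ → ℝ³`. -/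
def pd (e : Pt) (u : Pt → V3) (x : Pt) : V3 := fderiv ℝ u x e

def e1 : Pt := (1, 0, 0)
def e2 : Pt := (0, 1, 0)
def e3 : Pt := (0, 0, 1)

/-- Rescaled gradient ∇_h u = (∂₁u, ∂₂u, h⁻¹ ∂₃u), as a 3×3 matrix of columns. -/
def gradh (h : ℝ) (u : Pt → V3) (x : Pt) : M33 :=
  ![pd e1 u x, pd e2 u x, h⁻¹ • pd e3 u x]

/-- Squared rescaled Hessian |∇²_h u|². -/
def hessh (h : ℝ) (u : Pt → V3) (x : Pt) : ℝ :=
  (vnorm (pd e1 (pd e1 u) x)) ^ 2 + (vnorm (pd e2 (pd e2 u) x)) ^ 2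
    + (h⁻¹) ^ 4 * (vnorm (pd e3 (pd e3 u) x)) ^ 2
    + 2 * (vnorm (pd e2 (pd e1 u) x)) ^ 2
    + 2 * (h⁻¹) ^ 2 * (vnorm (pd e3 (pd e1 u) x)) ^ 2
    + 2 * (h⁻¹) ^ 2 * (vnorm (pd e3 (pd e2 u) x)) ^ 2

/-- The energy F^h_ε(u, S) = ∫_S (1/ε) W(∇_h u) + ε |∇²_h u|², valued in [0,∞]. -/
def F (W : M33 → ℝ) (h ε : ℝ) (u : Pt → V3) (S : Set Pt) : ℝ≥0∞ :=
  ∫⁻ x in S, ENNReal.ofReal (ε⁻¹ * W (gradh h u x) + ε * hessh h u x)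

/-- Hypothesis (H1): W ≥ 0, {W = 0} = {A, B}, A ≠ B, and A' − B' = 2 a ⊗ ν̄ for
some a ∈ ℝ³ and a unit vector ν̄ ∈ ℝ². -/
def H1 (W : M33 → ℝ) (A B : M33) : Prop :=
  (∀ ξ, 0 ≤ W ξ) ∧ (∀ ξ, W ξ = 0 ↔ ξ = A ∨ ξ = B) ∧ A ≠ B ∧
    ∃ (a : V3) (ν : ℝ × ℝ), ν.1 ^ 2 + ν.2 ^ 2 = 1 ∧
      A 0 - B 0 = (2 * ν.1) • a ∧ A 1 - B 1 = (2 * ν.2) • a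

/-- Hypothesis (H2): p-growth from above and below. -/
def H2 (W : M33 → ℝ) (p : ℝ) : Prop :=
  ∃ C > (0 : ℝ), ∀ ξ, C⁻¹ * (mnorm ξ) ^ p - C ≤ W ξ ∧ W ξ ≤ C * (mnorm ξ) ^ p + C

/-- Hypothesis (H3): non-degeneracy near the wells. -/
def H3 (W : M33 → ℝ) (A B : M33) (p : ℝ) : Prop :=
  ∃ ϱ > (0 : ℝ), ∃ C > (0 : ℝ), ∀ ξ, mdist A B ξ ≤ ϱ →
    C⁻¹ * (mdist A B ξ) ^ p ≤ W ξ ∧ W ξ ≤ C * (mdist A B ξ) ^ p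

/-- Hypothesis (H4): W(ξ₁, 0, ξ₃) ≤ W(ξ). -/
def H4 (W : M33 → ℝ) : Prop := ∀ ξ : M33, W ![ξ 0, 0, ξ 2] ≤ W ξ

/-- Normalization of the wells: A = −B, first column of A is a, second column is 0. -/
def Wells (A B : M33) (a : V3) : Prop := A = -B ∧ A 0 = a ∧ A 1 = 0

/-- ū₀(t) = |t| a. -/
def ub0 (a : V3) (t : ℝ) : V3 := |t| • a

/-- b̄₀(t) = A₃ for t ≥ 0, −A₃ (= B₃) for t < 0. -/
def bb0 (A3 : V3) (t : ℝ) : V3 := if 0 ≤ t then A3 else -A3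

/-- u₀(x) = ū₀(x₁). -/
def u0 (a : V3) (x : Pt) : V3 := ub0 a x.1

/-- b₀(x) = b̄₀(x₁). -/
def b0 (A3 : V3) (x : Pt) : V3 := bb0 A3 x.1

/-- The interval I = (−1/2, 1/2). -/
def II : Set ℝ := Set.Ioo (-(1 / 2 : ℝ)) (1 / 2)

/-- The unit cube Q = I × I × I. -/
def Q3 : Set Pt := II ×ˢ (II ×ˢ II)

/-- J_ρ = (ρ I) × J × I. -/
def Jrho (J : Set ℝ) (ρ : ℝ) : Set Pt := (Set.Ioo (-(ρ / 2)) (ρ / 2)) ×ˢ (J ×ˢ II)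

/-- The rescaled thin domain Ω = ω × I. -/
def Om (ω : Set (ℝ × ℝ)) : Set Pt := {x | (x.1, x.2.1) ∈ ω ∧ x.2.2 ∈ II}

/-- L¹ convergence on a set U. -/
def TendsL1 (U : Set Pt) (f : ℕ → Pt → V3) (g : Pt → V3) : Prop :=
  Tendsto (fun n => ∫⁻ x in U, ENNReal.ofReal (vnorm (f n x - g x))) atTop (nhds 0)

/-- L^q convergence on a set U. -/
def TendsLp (U : Set Pt) (q : ℝ) (f : ℕ → Pt → V3) (g : Pt → V3) : Prop :=
  Tendsto (fun n => ∫⁻ x in U, ENNReal.ofReal ((vnorm (f n x - g x)) ^ q)) atTop (nhds 0)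

/-- The localized asymptotic energy 𝓔_γ(J, ρ). -/
def Egam (W : M33 → ℝ) (a A3 : V3) (γ : ℝ) (J : Set ℝ) (ρ : ℝ) : ℝ≥0∞ :=
  sInf { L : ℝ≥0∞ | ∃ (h ε : ℕ → ℝ) (u : ℕ → Pt → V3),
    (∀ n, 0 < h n) ∧ (∀ n, 0 < ε n) ∧
    Tendsto h atTop (nhds 0) ∧ Tendsto ε atTop (nhds 0) ∧
    Tendsto (fun n => h n / ε n) atTop (nhds γ) ∧
    (∀ n, ContDiffOn ℝ 2 (u n) (Jrho J ρ)) ∧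
    TendsL1 (Jrho J ρ) u (u0 a) ∧
    TendsL1 (Jrho J ρ) (fun n x => (h n)⁻¹ • pd e3 (u n) x) (b0 A3) ∧
    L = Filter.liminf (fun n => F W (h n) (ε n) (u n) (Jrho J ρ)) atTop }

/-- K*_γ = 𝓔_γ(I, 1). -/
def Kstar (W : M33 → ℝ) (a A3 : V3) (γ : ℝ) : ℝ≥0∞ := Egam W a A3 γ II 1

/-- K*_∞ : the analogue of K*_γ for h/ε → ∞, on the unit cube Q. -/
def KstarInf (W : M33 → ℝ) (a A3 : V3) : ℝ≥0∞ :=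
  sInf { L : ℝ≥0∞ | ∃ (h ε : ℕ → ℝ) (u : ℕ → Pt → V3),
    (∀ n, 0 < h n) ∧ (∀ n, 0 < ε n) ∧
    Tendsto h atTop (nhds 0) ∧ Tendsto ε atTop (nhds 0) ∧
    Tendsto (fun n => h n / ε n) atTop atTop ∧
    (∀ n, ContDiffOn ℝ 2 (u n) Q3) ∧
    TendsL1 Q3 u (u0 a) ∧
    TendsL1 Q3 (fun n x => (h n)⁻¹ • pd e3 (u n) x) (b0 A3) ∧
    L = Filter.liminf (fun n => F W (h n) (ε n) (u n) Q3) atTop }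

open Classical in
/-- The phase matrix: B on E, A off E. -/
def Mfun (A B : M33) (E : Set (ℝ × ℝ)) (x' : ℝ × ℝ) : M33 := if x' ∈ E then B else A

/-! ### Two-dimensional objects -/

abbrev Pt2 := ℝ × ℝ

/-- Directional partial derivative of a map `v : ℝ² → ℝ³`. -/
def qd (e : Pt2) (v : Pt2 → V3) (y : Pt2) : V3 := fderiv ℝ v y e

def f1 : Pt2 := (1, 0)
def f2 : Pt2 := (0, 1)

/-- 𝒲(∇v) = W(∂₁v, 0, ∂₂v). -/
def W2 (W : M33 → ℝ) (v : Pt2 → V3) (y : Pt2) : ℝ := W ![qd f1 v y, 0, qd f2 v y]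

/-- Squared 2D Hessian |∇²v|². -/
def hess2d (v : Pt2 → V3) (y : Pt2) : ℝ :=
  (vnorm (qd f1 (qd f1 v) y)) ^ 2 + 2 * (vnorm (qd f2 (qd f1 v) y)) ^ 2
    + (vnorm (qd f2 (qd f2 v) y)) ^ 2

/-- The rectangle ℓI × γI. -/
def Rect (ℓ γ : ℝ) : Set Pt2 := Set.Ioo (-(ℓ / 2)) (ℓ / 2) ×ˢ Set.Ioo (-(γ / 2)) (γ / 2)

/-- The optimal-profile constant K_γ of the critical regime. -/
def Kgam (W : M33 → ℝ) (a A3 : V3) (γ : ℝ) : ℝ≥0∞ :=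
  sInf { L : ℝ≥0∞ | ∃ ℓ > (0 : ℝ), ∃ v : Pt2 → V3,
    ContDiffOn ℝ 2 v (Rect ℓ γ) ∧
    (∃ δ > (0 : ℝ), ∀ y ∈ Rect ℓ γ, ℓ / 2 - δ < y.1 → qd f1 v y = a ∧ qd f2 v y = A3) ∧
    (∃ δ > (0 : ℝ), ∀ y ∈ Rect ℓ γ, y.1 < -(ℓ / 2) + δ → qd f1 v y = -a ∧ qd f2 v y = -A3) ∧
    L = ENNReal.ofReal γ⁻¹ *
      ∫⁻ y in Rect ℓ γ, ENNReal.ofReal (W2 W v y + hess2d v y) }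

/-- The 2D subcritical functional F⁰_ε(u, b, D). -/
def F0 (W : M33 → ℝ) (ε : ℝ) (u b : Pt2 → V3) (D : Set Pt2) : ℝ≥0∞ :=
  ∫⁻ y in D, ENNReal.ofReal (ε⁻¹ * W ![qd f1 u y, qd f2 u y, b y]
    + ε * ((vnorm (qd f1 (qd f1 u) y)) ^ 2 + 2 * (vnorm (qd f2 (qd f1 u) y)) ^ 2
      + (vnorm (qd f2 (qd f2 u) y)) ^ 2
      + 2 * (vnorm (qd f1 b y)) ^ 2 + 2 * (vnorm (qd f2 b y)) ^ 2))

/-- K*₀: the subcritical cell constant. -/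
def Kstar0 (W : M33 → ℝ) (a A3 : V3) : ℝ≥0∞ :=
  sInf { L : ℝ≥0∞ | ∃ (ε : ℕ → ℝ) (u b : ℕ → Pt2 → V3),
    (∀ n, 0 < ε n) ∧ Tendsto ε atTop (nhds 0) ∧
    (∀ n, ContDiffOn ℝ 2 (u n) (II ×ˢ II)) ∧ (∀ n, ContDiffOn ℝ 1 (b n) (II ×ˢ II)) ∧
    Tendsto (fun n => ∫⁻ y in II ×ˢ II,
      ENNReal.ofReal (vnorm (u n y - ub0 a y.1) + vnorm (b n y - bb0 A3 y.1)))
      atTop (nhds 0) ∧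
    L = Filter.liminf (fun n => F0 W (ε n) (u n) (b n) (II ×ˢ II)) atTop }

/-- K₀: the subcritical optimal-profile constant. -/
def K0 (W : M33 → ℝ) (a A3 : V3) : ℝ≥0∞ :=
  sInf { L : ℝ≥0∞ | ∃ ℓ > (0 : ℝ), ∃ φ1 φ2 : ℝ → V3,
    ContDiffOn ℝ 1 φ1 (Set.Icc (-ℓ) ℓ) ∧ ContDiffOn ℝ 1 φ2 (Set.Icc (-ℓ) ℓ) ∧
    φ1 ℓ = a ∧ φ2 ℓ = A3 ∧ φ1 (-ℓ) = -a ∧ φ2 (-ℓ) = -A3 ∧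
    L = ∫⁻ t in Set.Ioo (-ℓ) ℓ, ENNReal.ofReal (W ![φ1 t, 0, φ2 t]
      + (vnorm (derivWithin φ1 (Set.Icc (-ℓ) ℓ) t)) ^ 2
      + 2 * (vnorm (derivWithin φ2 (Set.Icc (-ℓ) ℓ) t)) ^ 2) }

/-- K_∞ in the case λ = 0. -/
def KinfZero (W : M33 → ℝ) (a : V3) : ℝ≥0∞ :=
  sInf { L : ℝ≥0∞ | ∃ ℓ > (0 : ℝ), ∃ v : Pt2 → V3,
    ContDiff ℝ 2 v ∧ (∀ y : Pt2, v (y.1, y.2 + 1) = v y) ∧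
    (∃ δ > (0 : ℝ), ∀ y : Pt2, |y.1 - 1 / 2| < δ → qd f1 v y = a ∧ qd f2 v y = 0) ∧
    (∃ δ > (0 : ℝ), ∀ y : Pt2, |y.1 + 1 / 2| < δ → qd f1 v y = -a ∧ qd f2 v y = 0) ∧
    L = ∫⁻ y in II ×ˢ II, ENNReal.ofReal (ℓ * W2 W v y + ℓ⁻¹ * hess2d v y) }

/-- The unit normal ν_λ = (1+λ²)^{-1/2} (1, λ). -/
def nuv (lam : ℝ) : Pt2 := (1 / Real.sqrt (1 + lam ^ 2), lam / Real.sqrt (1 + lam ^ 2))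

/-- The orthogonal direction ν_λ^⊥ = (1+λ²)^{-1/2} (−λ, 1). -/
def nupv (lam : ℝ) : Pt2 := (-lam / Real.sqrt (1 + lam ^ 2), 1 / Real.sqrt (1 + lam ^ 2))

/-- Dot product on ℝ². -/
def dotp (w y : Pt2) : ℝ := w.1 * y.1 + w.2 * y.2

/-- The unit square Q'_λ centered at 0 with two sides orthogonal to ν_λ. -/
def Qlam (lam : ℝ) : Set Pt2 := {y | |dotp (nuv lam) y| < 1 / 2 ∧ |dotp (nupv lam) y| < 1 / 2}

/-- K_∞ for general λ. -/
def KinfL (W : M33 → ℝ) (a : V3) (lam : ℝ) : ℝ≥0∞ :=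
  ENNReal.ofReal (Real.sqrt (1 + lam ^ 2)) *
    sInf { L : ℝ≥0∞ | ∃ ℓ > (0 : ℝ), ∃ v : Pt2 → V3,
      ContDiff ℝ 2 v ∧ (∀ y : Pt2, v (y + nupv lam) = v y) ∧
      (∃ δ > (0 : ℝ), ∀ y : Pt2, |dotp (nuv lam) y - 1 / 2| < δ →
        qd f1 v y = a ∧ qd f2 v y = lam • a) ∧
      (∃ δ > (0 : ℝ), ∀ y : Pt2, |dotp (nuv lam) y + 1 / 2| < δ →
        qd f1 v y = -a ∧ qd f2 v y = -(lam • a)) ∧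
      L = ∫⁻ y in Qlam lam, ENNReal.ofReal (ℓ * W2 W v y + ℓ⁻¹ * hess2d v y) }

/-- Number of interfaces strictly below t. -/
def cnt (m : ℕ) (α : Fin m → ℝ) (t : ℝ) : ℕ := (Finset.univ.filter (fun i => α i < t)).card

end

/-- The diagonal map `x ↦ (α⁻¹ x₁, α⁻¹ x₂, x₃)`. -/
noncomputable def dilEquiv {α : ℝ} (hα : 0 < α) : Pt ≃L[ℝ] Pt :=
  LinearEquiv.toContinuousLinearEquiv
    { toFun := fun x => (α⁻¹ * x.1, α⁻¹ * x.2.1, x.2.2)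
      invFun := fun x => (α * x.1, α * x.2.1, x.2.2)
      map_add' := fun x y => by simp [mul_add]
      map_smul' := fun r x => by simp [mul_left_comm]
      left_inv := fun x => by simp [hα.ne']
      right_inv := fun x => by simp [hα.ne'] }

lemma dilEquiv_apply {α : ℝ} (hα : 0 < α) (x : Pt) :
    dilEquiv hα x = (α⁻¹ * x.1, α⁻¹ * x.2.1, x.2.2) := rfl

/-- The diagonal map after a translation by `-t` in the second variable. -/
noncomputable def dilShift {α : ℝ} (hα : 0 < α) (t : ℝ) (x : Pt) : Pt := dilEquiv hα (x + (0, -t, 0))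

lemma dilShift_apply {α : ℝ} (hα : 0 < α) (t : ℝ) (x : Pt) :
    dilShift hα t x = (α⁻¹ * x.1, α⁻¹ * (x.2.1 - t), x.2.2) := by
  simp [dilShift, dilEquiv_apply, sub_eq_add_neg]

lemma contDiff_dilShift {α : ℝ} (hα : 0 < α) (t : ℝ) : ContDiff ℝ 2 (dilShift hα t) :=
  (dilEquiv hα).contDiff.comp (contDiff_id.add contDiff_const)

lemma pd_comp_dilShift {α : ℝ} (hα : 0 < α) (t : ℝ) (e : Pt) (u : Pt → V3) :
    pd e (u ∘ dilShift hα t) = pd (dilEquiv hα e) u ∘ dilShift hα t := by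
  funext x
  have h := fderiv_comp_add_right (𝕜 := ℝ) (f := u ∘ dilEquiv hα) (x := x) (0, -t, 0)
  have h' := (dilEquiv hα).comp_right_fderiv (f := u) (x := x + (0, -t, 0))
  change fderiv ℝ (fun y => (u ∘ dilEquiv hα) (y + (0, -t, 0))) x e = _
  rw [h, h']
  rfl

lemma pd_const_smul (e : Pt) (r : ℝ) (u : Pt → V3) : pd e (r • u) = r • pd e u := by
  funext x
  simp [pd, fderiv_const_smul_field]

lemma pd_smul_dir (r : ℝ) (e : Pt) (u : Pt → V3) : pd (r • e) u = r • pd e u := by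
  funext x
  simp [pd]

lemma dilEquiv_e1 {α : ℝ} (hα : 0 < α) : dilEquiv hα e1 = α⁻¹ • e1 := by
  simp [dilEquiv_apply, e1]

lemma dilEquiv_e2 {α : ℝ} (hα : 0 < α) : dilEquiv hα e2 = α⁻¹ • e2 := by
  simp [dilEquiv_apply, e2]

lemma dilEquiv_e3 {α : ℝ} (hα : 0 < α) : dilEquiv hα e3 = e3 := by
  simp [dilEquiv_apply, e3]

lemma pd_e1_comp {α : ℝ} (hα : 0 < α) (t : ℝ) (u : Pt → V3) :
    pd e1 (u ∘ dilShift hα t) = α⁻¹ • (pd e1 u ∘ dilShift hα t) := by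
  rw [pd_comp_dilShift, dilEquiv_e1, pd_smul_dir]; rfl

lemma pd_e2_comp {α : ℝ} (hα : 0 < α) (t : ℝ) (u : Pt → V3) :
    pd e2 (u ∘ dilShift hα t) = α⁻¹ • (pd e2 u ∘ dilShift hα t) := by
  rw [pd_comp_dilShift, dilEquiv_e2, pd_smul_dir]; rfl

lemma pd_e3_comp {α : ℝ} (hα : 0 < α) (t : ℝ) (u : Pt → V3) :
    pd e3 (u ∘ dilShift hα t) = pd e3 u ∘ dilShift hα t := by
  rw [pd_comp_dilShift, dilEquiv_e3]

lemma vnorm_smul (r : ℝ) (v : V3) : vnorm (r • v) = |r| * vnorm v := by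
  simp only [vnorm, Pi.smul_apply, smul_eq_mul, mul_pow, ← Finset.mul_sum]
  rw [Real.sqrt_mul (sq_nonneg r), Real.sqrt_sq_eq_abs]

/-- The rescaled map `x ↦ α u(x₁/α, (x₂-t)/α, x₃)`. -/
noncomputable def rescale {α : ℝ} (hα : 0 < α) (t : ℝ) (u : Pt → V3) : Pt → V3 := α • (u ∘ dilShift hα t)

lemma pd_e1_rescale {α : ℝ} (hα : 0 < α) (t : ℝ) (u : Pt → V3) :
    pd e1 (rescale hα t u) = pd e1 u ∘ dilShift hα t := by
  rw [rescale, pd_const_smul, pd_e1_comp, smul_inv_smul₀ hα.ne']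

lemma pd_e2_rescale {α : ℝ} (hα : 0 < α) (t : ℝ) (u : Pt → V3) :
    pd e2 (rescale hα t u) = pd e2 u ∘ dilShift hα t := by
  rw [rescale, pd_const_smul, pd_e2_comp, smul_inv_smul₀ hα.ne']

lemma pd_e3_rescale {α : ℝ} (hα : 0 < α) (t : ℝ) (u : Pt → V3) :
    pd e3 (rescale hα t u) = α • (pd e3 u ∘ dilShift hα t) := by
  rw [rescale, pd_const_smul, pd_e3_comp]

lemma inv_smul_pd_e3_rescale {α : ℝ} (hα : 0 < α) (t h : ℝ) (u : Pt → V3) (x : Pt) :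
    (α * h)⁻¹ • pd e3 (rescale hα t u) x = h⁻¹ • pd e3 u (dilShift hα t x) := by
  rw [pd_e3_rescale, Pi.smul_apply, smul_smul, mul_inv, mul_right_comm, inv_mul_cancel₀ hα.ne',
    one_mul]
  rfl

lemma gradh_rescale {α : ℝ} (hα : 0 < α) (t h : ℝ) (u : Pt → V3) (x : Pt) :
    gradh (α * h) (rescale hα t u) x = gradh h u (dilShift hα t x) := by
  rw [gradh, inv_smul_pd_e3_rescale, pd_e1_rescale, pd_e2_rescale]
  rfl

lemma hessh_rescale {α : ℝ} (hα : 0 < α) (t h : ℝ) (u : Pt → V3) (x : Pt) :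
    hessh (α * h) (rescale hα t u) x = (α⁻¹) ^ 2 * hessh h u (dilShift hα t x) := by
  simp only [hessh, pd_e1_rescale, pd_e2_rescale, pd_e3_rescale, pd_const_smul, pd_e1_comp,
    pd_e2_comp, pd_e3_comp, Pi.smul_apply, vnorm_smul, mul_pow, sq_abs, mul_inv,
    Function.comp_apply]
  have h4 : (α⁻¹) ^ 4 * α ^ 2 = (α⁻¹) ^ 2 := by field_simp
  linear_combination (h⁻¹) ^ 4 * vnorm (pd e3 (pd e3 u) (dilShift hα t x)) ^ 2 * h4

lemma measurePreserving_dilShift {α : ℝ} (hα : 0 < α) (t : ℝ) :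
    MeasurePreserving (dilShift hα t) volume (ENNReal.ofReal (α ^ 2) • volume) := by
  have h1 : MeasurePreserving (fun s : ℝ => α⁻¹ * s) volume (ENNReal.ofReal α • volume) :=
    ⟨measurable_const_mul _, by
      rw [Real.map_volume_mul_left (inv_ne_zero hα.ne'), inv_inv, abs_of_pos hα]⟩
  have h2 : MeasurePreserving (fun s : ℝ => α⁻¹ * (s - t)) volume (ENNReal.ofReal α • volume) :=
    h1.comp (measurePreserving_sub_right volume t)
  have h := h1.prod (h2.prod (MeasurePreserving.id (volume : Measure ℝ)))
  rw [Measure.prod_smul_left, Measure.prod_smul_left, Measure.prod_smul_right, smul_smul,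
    ← ENNReal.ofReal_mul hα.le, ← sq] at h
  have heq : dilShift hα t
      = Prod.map (fun s : ℝ => α⁻¹ * s) (Prod.map (fun s : ℝ => α⁻¹ * (s - t)) id) :=
    funext (dilShift_apply hα t)
  rw [heq]
  exact h

lemma measurableEmbedding_dilShift {α : ℝ} (hα : 0 < α) (t : ℝ) :
    MeasurableEmbedding (dilShift hα t) :=
  (contDiff_dilShift hα t).continuous.measurableEmbedding
    ((dilEquiv hα).injective.comp (add_left_injective _))

lemma lintegral_comp_dilShift {α : ℝ} (hα : 0 < α) (t : ℝ) (f : Pt → ℝ≥0∞) (S : Set Pt) :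
    ∫⁻ x in dilShift hα t ⁻¹' S, f (dilShift hα t x)
      = ENNReal.ofReal (α ^ 2) * ∫⁻ x in S, f x := by
  rw [(measurePreserving_dilShift hα t).setLIntegral_comp_preimage_emb
    (measurableEmbedding_dilShift hα t), Measure.restrict_smul, lintegral_smul_measure,
    smul_eq_mul]

lemma dilShift_preimage_Jrho {α : ℝ} (hα : 0 < α) (t c d ρ : ℝ) :
    dilShift hα t ⁻¹' Jrho (Ioo c d) ρ = Jrho (Ioo (α * c + t) (α * d + t)) (α * ρ) := by
  ext ⟨x, y, z⟩
  have k : ∀ s : ℝ, α * (α⁻¹ * s) = s := fun s => mul_inv_cancel_left₀ hα.ne' s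
  have l1 : ∀ s r : ℝ, s < α⁻¹ * r ↔ α * s < r := fun s r => by
    rw [← mul_lt_mul_iff_right₀ hα, k]
  have l2 : ∀ s r : ℝ, α⁻¹ * r < s ↔ r < α * s := fun s r => by
    rw [← mul_lt_mul_iff_right₀ hα, k]
  simp only [mem_preimage, dilShift_apply, Jrho, mem_prod, mem_Ioo, l1, l2, lt_sub_iff_add_lt,
    sub_lt_iff_lt_add, mul_neg, mul_div_assoc]

lemma F_rescale (W : M33 → ℝ) {α : ℝ} (hα : 0 < α) (t h ε : ℝ) (u : Pt → V3) (S : Set Pt) :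
    F W (α * h) (α * ε) (rescale hα t u) (dilShift hα t ⁻¹' S)
      = ENNReal.ofReal α * F W h ε u S := by
  have hpt : ∀ x, ENNReal.ofReal ((α * ε)⁻¹ * W (gradh (α * h) (rescale hα t u) x)
      + α * ε * hessh (α * h) (rescale hα t u) x) = ENNReal.ofReal α⁻¹ *
        ENNReal.ofReal (ε⁻¹ * W (gradh h u (dilShift hα t x))
          + ε * hessh h u (dilShift hα t x)) := fun x => by
    rw [gradh_rescale, hessh_rescale, ← ENNReal.ofReal_mul (inv_nonneg.2 hα.le), mul_inv]
    congr 1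
    field_simp
  unfold F
  simp_rw [hpt]
  rw [lintegral_const_mul' _ _ ENNReal.ofReal_ne_top, lintegral_comp_dilShift hα t
    (fun x => ENNReal.ofReal (ε⁻¹ * W (gradh h u x) + ε * hessh h u x)), ← mul_assoc,
    ← ENNReal.ofReal_mul (inv_nonneg.2 hα.le)]
  congr 2
  field_simp

lemma u0_rescale (a : V3) {α : ℝ} (hα : 0 < α) (t : ℝ) : u0 a = rescale hα t (u0 a) := by
  funext x
  simp [u0, ub0, rescale, dilShift_apply, smul_smul, abs_mul, abs_inv, abs_of_pos hα, hα.ne']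

lemma b0_dilShift (A3 : V3) {α : ℝ} (hα : 0 < α) (t : ℝ) (x : Pt) :
    b0 A3 (dilShift hα t x) = b0 A3 x := by
  simp [b0, bb0, dilShift_apply, hα]

lemma TendsL1.comp_dilShift {S : Set Pt} {f : ℕ → Pt → V3} {g : Pt → V3} (h : TendsL1 S f g)
    {α : ℝ} (hα : 0 < α) (t : ℝ) :
    TendsL1 (dilShift hα t ⁻¹' S) (fun n => f n ∘ dilShift hα t) (g ∘ dilShift hα t) := by
  have h' := ENNReal.Tendsto.const_mul (a := ENNReal.ofReal (α ^ 2)) h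
    (Or.inr ENNReal.ofReal_ne_top)
  rw [mul_zero] at h'
  refine h'.congr fun n => ?_
  exact (lintegral_comp_dilShift hα t (fun x => ENNReal.ofReal (vnorm (f n x - g x))) S).symm

lemma TendsL1.const_smul {S : Set Pt} {f : ℕ → Pt → V3} {g : Pt → V3} (h : TendsL1 S f g)
    (r : ℝ) : TendsL1 S (fun n => r • f n) (r • g) := by
  have h' := ENNReal.Tendsto.const_mul (a := ENNReal.ofReal |r|) h (Or.inr ENNReal.ofReal_ne_top)
  rw [mul_zero] at h'
  refine h'.congr fun n => ?_
  rw [← lintegral_const_mul' _ _ ENNReal.ofReal_ne_top]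
  refine lintegral_congr fun x => ?_
  rw [← ENNReal.ofReal_mul (abs_nonneg r), ← vnorm_smul, smul_sub]
  rfl

lemma TendsL1.mono {S T : Set Pt} {f : ℕ → Pt → V3} {g : Pt → V3} (h : TendsL1 T f g)
    (hST : S ⊆ T) : TendsL1 S f g :=
  tendsto_of_tendsto_of_tendsto_of_le_of_le tendsto_const_nhds h (fun _ => zero_le)
    fun _ => lintegral_mono_set hST

lemma Egam_le_liminf {W : M33 → ℝ} {a A3 : V3} {γ : ℝ} {J K : Set ℝ} {ρ r : ℝ}
    (hsub : Jrho J ρ ⊆ Jrho K r) {h ε : ℕ → ℝ} {u : ℕ → Pt → V3}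
    (hh : ∀ n, 0 < h n) (hε : ∀ n, 0 < ε n) (hh0 : Tendsto h atTop (𝓝 0))
    (hε0 : Tendsto ε atTop (𝓝 0)) (hγ : Tendsto (fun n => h n / ε n) atTop (𝓝 γ))
    (hu : ∀ n, ContDiffOn ℝ 2 (u n) (Jrho K r)) (hL : TendsL1 (Jrho K r) u (u0 a))
    (hb : TendsL1 (Jrho K r) (fun n x => (h n)⁻¹ • pd e3 (u n) x) (b0 A3)) :
    Egam W a A3 γ J ρ ≤ liminf (fun n => F W (h n) (ε n) (u n) (Jrho J ρ)) atTop :=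
  sInf_le ⟨h, ε, u, hh, hε, hh0, hε0, hγ, fun n => (hu n).mono hsub, hL.mono hsub,
    hb.mono hsub, rfl⟩

lemma Jrho_mono {J K : Set ℝ} {ρ r : ℝ} (hJ : J ⊆ K) (hρ : ρ ≤ r) : Jrho J ρ ⊆ Jrho K r :=
  prod_mono (Ioo_subset_Ioo (by linarith) (by linarith)) (prod_mono hJ Subset.rfl)

lemma Egam_mono_width (W : M33 → ℝ) (a A3 : V3) (γ : ℝ) (J : Set ℝ) {ρ r : ℝ} (hρ : ρ ≤ r) :
    Egam W a A3 γ J ρ ≤ Egam W a A3 γ J r := by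
  refine le_sInf ?_
  rintro _ ⟨h, ε, u, hh, hε, hh0, hε0, hγ, hu, hL, hb, rfl⟩
  have hsub := Jrho_mono (Subset.refl J) hρ
  exact (Egam_le_liminf hsub hh hε hh0 hε0 hγ hu hL hb).trans
    (liminf_le_liminf (Eventually.of_forall fun n => lintegral_mono_set hsub))

lemma measurableSet_Jrho {J : Set ℝ} (hJ : MeasurableSet J) (ρ : ℝ) : MeasurableSet (Jrho J ρ) :=
  measurableSet_Ioo.prod (hJ.prod measurableSet_Ioo)

lemma add_liminf_le_liminf_add (f g : ℕ → ℝ≥0∞) :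
    liminf f atTop + liminf g atTop ≤ liminf (fun n => f n + g n) atTop := by
  simp only [liminf_eq_iSup_iInf_of_nat]
  rw [ENNReal.iSup_add_iSup_of_monotone
    (fun m n hmn => biInf_mono fun _ hi => le_trans hmn hi)
    (fun m n hmn => biInf_mono fun _ hi => le_trans hmn hi)]
  exact iSup_mono fun n => le_iInf₂ fun i hi => add_le_add (biInf_le _ hi) (biInf_le _ hi)

lemma Egam_add_le (W : M33 → ℝ) (a A3 : V3) (γ ρ : ℝ) {J₁ J₂ K : Set ℝ}
    (hJ₂ : MeasurableSet J₂) (hdisj : Disjoint J₁ J₂) (h₁ : J₁ ⊆ K) (h₂ : J₂ ⊆ K) :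
    Egam W a A3 γ J₁ ρ + Egam W a A3 γ J₂ ρ ≤ Egam W a A3 γ K ρ := by
  refine le_sInf ?_
  rintro _ ⟨h, ε, u, hh, hε, hh0, hε0, hγ, hu, hL, hb, rfl⟩
  have hs₁ := Jrho_mono h₁ (le_refl ρ)
  have hs₂ := Jrho_mono h₂ (le_refl ρ)
  have hd : Disjoint (Jrho J₁ ρ) (Jrho J₂ ρ) :=
    Set.disjoint_prod.2 (Or.inr (Set.disjoint_prod.2 (Or.inl hdisj)))
  refine (add_le_add (Egam_le_liminf hs₁ hh hε hh0 hε0 hγ hu hL hb)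
    (Egam_le_liminf hs₂ hh hε hh0 hε0 hγ hu hL hb)).trans ?_
  refine (add_liminf_le_liminf_add _ _).trans (liminf_le_liminf (Eventually.of_forall fun n => ?_))
  change F W (h n) (ε n) (u n) (Jrho J₁ ρ) + F W (h n) (ε n) (u n) (Jrho J₂ ρ) ≤ _
  unfold F
  rw [← lintegral_union (measurableSet_Jrho hJ₂ ρ) hd]
  exact lintegral_mono_set (union_subset hs₁ hs₂)

lemma Egam_dil_le (W : M33 → ℝ) (a A3 : V3) (γ : ℝ) {α : ℝ} (hα : 0 < α) (t c d ρ : ℝ) :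
    Egam W a A3 γ (Ioo (α * c + t) (α * d + t)) (α * ρ)
      ≤ ENNReal.ofReal α * Egam W a A3 γ (Ioo c d) ρ := by
  have hα0 : ENNReal.ofReal α ≠ 0 := (ENNReal.ofReal_pos.2 hα).ne'
  rw [← ENNReal.inv_mul_le_iff hα0 ENNReal.ofReal_ne_top]
  refine le_sInf ?_
  rintro _ ⟨h, ε, u, hh, hε, hh0, hε0, hγ, hu, hL, hb, rfl⟩
  rw [ENNReal.inv_mul_le_iff hα0 ENNReal.ofReal_ne_top,
    ← ENNReal.liminf_const_mul_of_ne_top ENNReal.ofReal_ne_top]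
  refine sInf_le ⟨fun n => α * h n, fun n => α * ε n, fun n => rescale hα t (u n),
    fun n => mul_pos hα (hh n), fun n => mul_pos hα (hε n), ?_, ?_, ?_, fun n => ?_, ?_, ?_, ?_⟩
  · simpa using hh0.const_mul α
  · simpa using hε0.const_mul α
  · exact hγ.congr fun n => (mul_div_mul_left _ _ hα.ne').symm
  · rw [← dilShift_preimage_Jrho hα]
    exact ((hu n).comp (contDiff_dilShift hα t).contDiffOn fun _ hx => hx).const_smul α
  · rw [← dilShift_preimage_Jrho hα, u0_rescale a hα t]
    exact (hL.comp_dilShift hα t).const_smul α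
  · rw [← dilShift_preimage_Jrho hα]
    simp only [inv_smul_pd_e3_rescale]
    have hb' := hb.comp_dilShift hα t
    rwa [show b0 A3 ∘ dilShift hα t = b0 A3 from funext (b0_dilShift A3 hα t)] at hb'
  · simp only [← dilShift_preimage_Jrho hα, F_rescale]

lemma Egam_dil (W : M33 → ℝ) (a A3 : V3) (γ : ℝ) {α : ℝ} (hα : 0 < α) (t c d ρ : ℝ) :
    Egam W a A3 γ (Ioo (α * c + t) (α * d + t)) (α * ρ)
      = ENNReal.ofReal α * Egam W a A3 γ (Ioo c d) ρ := by
  refine (Egam_dil_le W a A3 γ hα t c d ρ).antisymm ?_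
  have h := Egam_dil_le W a A3 γ (inv_pos.2 hα) (-(α⁻¹ * t)) (α * c + t) (α * d + t) (α * ρ)
  have e : ∀ s : ℝ, α⁻¹ * (α * s + t) + -(α⁻¹ * t) = s := fun s => by field_simp; ring
  rw [e, e, inv_mul_cancel_left₀ hα.ne', ENNReal.ofReal_inv_of_pos hα] at h
  rwa [ENNReal.mul_le_iff_le_inv (ENNReal.ofReal_pos.2 hα).ne' ENNReal.ofReal_ne_top]

lemma Egam_two_mul_width (W : M33 → ℝ) (a A3 : V3) (γ c d ρ : ℝ) (hcd : c < d) (hρ : 0 < ρ) :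
    Egam W a A3 γ (Ioo c d) (2 * ρ) = Egam W a A3 γ (Ioo c d) ρ := by
  refine le_antisymm ?_ (Egam_mono_width W a A3 γ _ (by linarith))
  have hadd := Egam_add_le W a A3 γ ρ (J₁ := Ioo c ((c + d) / 2)) (J₂ := Ioo ((c + d) / 2) d)
    (K := Ioo c d) measurableSet_Ioo
    (Set.disjoint_left.2 fun x hx hy => lt_asymm hx.2 hy.1)
    (Ioo_subset_Ioo_right (by linarith)) (Ioo_subset_Ioo_left (by linarith))
  have hl := Egam_dil W a A3 γ two_pos (-c) c ((c + d) / 2) ρ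
  have hr := Egam_dil W a A3 γ two_pos (-d) ((c + d) / 2) d ρ
  rw [show 2 * c + -c = c by ring, show 2 * ((c + d) / 2) + -c = d by ring] at hl
  rw [show 2 * d + -d = d by ring, show 2 * ((c + d) / 2) + -d = c by ring] at hr
  have hlr := hl.symm.trans hr
  have h2 : ENNReal.ofReal 2 = 2 := by simp
  rw [ENNReal.mul_right_inj (by simp) ENNReal.ofReal_ne_top] at hlr
  rwa [← hlr, ← two_mul, ← h2, ← hl] at hadd

lemma Egam_two_pow_mul_width (W : M33 → ℝ) (a A3 : V3) (γ c d ρ : ℝ) (hcd : c < d) (hρ : 0 < ρ)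
    (k : ℕ) : Egam W a A3 γ (Ioo c d) (2 ^ k * ρ) = Egam W a A3 γ (Ioo c d) ρ := by
  induction k with
  | zero => simp
  | succ k ih =>
    rw [pow_succ', mul_assoc, Egam_two_mul_width W a A3 γ c d _ hcd (by positivity), ih]

lemma Egam_le_of_width (W : M33 → ℝ) (a A3 : V3) (γ c d : ℝ) (hcd : c < d) {ρ : ℝ} (hρ : 0 < ρ)
    (r : ℝ) : Egam W a A3 γ (Ioo c d) r ≤ Egam W a A3 γ (Ioo c d) ρ := by
  obtain ⟨k, hk⟩ := pow_unbounded_of_one_lt (r / ρ) one_lt_two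
  rw [← Egam_two_pow_mul_width W a A3 γ c d ρ hcd hρ k]
  exact Egam_mono_width W a A3 γ _ ((div_lt_iff₀ hρ).1 hk).le

lemma Egam_width_eq (W : M33 → ℝ) (a A3 : V3) (γ c d : ℝ) (hcd : c < d) {ρ r : ℝ} (hρ : 0 < ρ)
    (hr : 0 < r) : Egam W a A3 γ (Ioo c d) ρ = Egam W a A3 γ (Ioo c d) r :=
  le_antisymm (Egam_le_of_width W a A3 γ c d hcd hr ρ) (Egam_le_of_width W a A3 γ c d hcd hρ r)

/-- Lemma 4.2 (vi)–(vii), Remark 4.3: for every nonempty bounded open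
interval J and every ρ > 0, 𝓔_γ(J, ρ) = K*_γ · ℒ¹(J). -/
theorem statement5 (p : ℝ) (hp : 2 ≤ p) (A B : M33) (W : M33 → ℝ) (a : V3)
    (hWc : Continuous W) (h1 : H1 W A B) (h2 : H2 W p)
    (hwells : Wells A B a) (γ : ℝ) (hγ : 0 < γ) :
    ∀ c d : ℝ, c < d → ∀ ρ > (0 : ℝ),
      Egam W a (A 2) γ (Set.Ioo c d) ρ = Kstar W a (A 2) γ * volume (Set.Ioo c d) := by
  intro c d hcd ρ hρ
  have hdc : 0 < d - c := sub_pos.2 hcd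
  have h := Egam_dil W a (A 2) γ hdc ((c + d) / 2) (-(1 / 2)) (1 / 2) 1
  rw [show (d - c) * -(1 / 2) + (c + d) / 2 = c by ring,
    show (d - c) * (1 / 2) + (c + d) / 2 = d by ring] at h
  rw [Egam_width_eq W a (A 2) γ c d hcd hρ (mul_pos hdc one_pos), h, Real.volume_Ioo, mul_comm]
  rfl
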